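/- Let n ≥ 3 and suppose φ : (ℝ^n \ {e}) × (-∞,0] → ℝ is a bounded classical solution of the heat equation ∂_τ φ = Δφ satisfying |φ(z,τ)| ≤ |z - e|^{-α} for some α ∈ (0, n-2) and a fixed unit vector e. Then φ ≡ 0. -/

import Mathlib

open scoped BigOperators

/-- The Euclidean Laplacian of `u : ℝⁿ → ℝ` at `x`. -/
noncomputable def laplacian (n : ℕ) (u : EuclideanSpace ℝ (Fin n) → ℝ)
    (x : EuclideanSpace ℝ (Fin n)) : ℝ :=
  ∑ i : Fin n, fderiv ℝ (fun y => fderiv ℝ u y (EuclideanSpace.single i 1)) x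
    (EuclideanSpace.single i 1)

section

open Set Filter Topology MeasureTheory

variable {n : ℕ}

local notation "𝔼" => EuclideanSpace ℝ (Fin n)

/-! ### Calculus of the Laplacian -/

lemma ContDiffAt.differentiableAt_fderiv_apply {f : 𝔼 → ℝ} {x : 𝔼} (hf : ContDiffAt ℝ 2 f x)
    (v : 𝔼) : DifferentiableAt ℝ (fun y => fderiv ℝ f y v) x :=
  ((hf.fderiv_right (m := 1) (by norm_num)).differentiableAt (by norm_num)).clm_apply
    (differentiableAt_const v)

lemma ContDiffAt.eventually_differentiableAt_two {f : 𝔼 → ℝ} {x : 𝔼} (hf : ContDiffAt ℝ 2 f x) :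
    ∀ᶠ y in 𝓝 x, DifferentiableAt ℝ f y :=
  (hf.eventually (by simp)).mono fun _ hy => hy.differentiableAt (by norm_num)

lemma laplacian_congr {f g : 𝔼 → ℝ} {x : 𝔼} (h : f =ᶠ[𝓝 x] g) :
    laplacian n f x = laplacian n g x := by
  refine Finset.sum_congr rfl fun i _ => ?_
  have : (fun y => fderiv ℝ f y (EuclideanSpace.single i 1)) =ᶠ[𝓝 x]
      fun y => fderiv ℝ g y (EuclideanSpace.single i 1) :=
    (h.fderiv (𝕜 := ℝ)).mono fun y hy => by simp only [hy]
  rw [this.fderiv_eq]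

lemma laplacian_add {f g : 𝔼 → ℝ} {x : 𝔼} (hf : ContDiffAt ℝ 2 f x) (hg : ContDiffAt ℝ 2 g x) :
    laplacian n (fun y => f y + g y) x = laplacian n f x + laplacian n g x := by
  simp only [laplacian, ← Finset.sum_add_distrib]
  refine Finset.sum_congr rfl fun i _ => ?_
  have : (fun y => fderiv ℝ (fun y => f y + g y) y (EuclideanSpace.single i 1)) =ᶠ[𝓝 x]
      fun y => fderiv ℝ f y (EuclideanSpace.single i 1) +
        fderiv ℝ g y (EuclideanSpace.single i 1) := by
    filter_upwards [hf.eventually_differentiableAt_two, hg.eventually_differentiableAt_two]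
      with y h1 h2
    rw [fderiv_fun_add h1 h2]
    rfl
  rw [this.fderiv_eq, fderiv_fun_add (hf.differentiableAt_fderiv_apply _)
    (hg.differentiableAt_fderiv_apply _)]
  rfl

lemma laplacian_const_mul {f : 𝔼 → ℝ} {x : 𝔼} (c : ℝ) (hf : ContDiffAt ℝ 2 f x) :
    laplacian n (fun y => c * f y) x = c * laplacian n f x := by
  simp only [laplacian, Finset.mul_sum]
  refine Finset.sum_congr rfl fun i _ => ?_
  have : (fun y => fderiv ℝ (fun y => c * f y) y (EuclideanSpace.single i 1)) =ᶠ[𝓝 x]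
      fun y => c * fderiv ℝ f y (EuclideanSpace.single i 1) := by
    filter_upwards [hf.eventually_differentiableAt_two] with y h1
    rw [fderiv_const_mul h1]
    rfl
  rw [this.fderiv_eq, fderiv_const_mul (hf.differentiableAt_fderiv_apply _)]
  rfl

lemma laplacian_sub {f g : 𝔼 → ℝ} {x : 𝔼} (hf : ContDiffAt ℝ 2 f x) (hg : ContDiffAt ℝ 2 g x) :
    laplacian n (fun y => f y - g y) x = laplacian n f x - laplacian n g x := by
  have h := laplacian_add hf ((contDiffAt_const (c := (-1 : ℝ))).mul hg)
  rw [laplacian_const_mul (-1) hg] at h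
  simpa [sub_eq_add_neg] using h

lemma laplacian_const (c : ℝ) (x : 𝔼) : laplacian n (fun _ => c) x = 0 := by
  simp [laplacian]

lemma laplacian_comp_const_add (f : 𝔼 → ℝ) (y x : 𝔼) :
    laplacian n (fun z => f (y + z)) x = laplacian n f (y + x) := by
  refine Finset.sum_congr rfl fun i _ => ?_
  simp only [fderiv_comp_add_left]
  rw [fderiv_comp_add_left (f := fun y => fderiv ℝ f y (EuclideanSpace.single i 1))]

lemma laplacian_comp_const_sub (f : 𝔼 → ℝ) (y x : 𝔼) :
    laplacian n (fun z => f (y - z)) x = laplacian n f (y - x) := by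
  have key (g : 𝔼 → ℝ) (w v : 𝔼) : fderiv ℝ (fun z => g (y - z)) w v
      = - fderiv ℝ g (y - w) v := by
    have h := (ContinuousLinearEquiv.neg ℝ (M := 𝔼)).comp_right_fderiv
      (f := fun z => g (y + z)) (x := w)
    have hfun : (fun z => g (y + z)) ∘ (ContinuousLinearEquiv.neg ℝ (M := 𝔼))
        = fun z => g (y - z) := by
      ext z
      simp [sub_eq_add_neg]
    rw [hfun, fderiv_comp_add_left] at h
    rw [h]
    simp [sub_eq_add_neg]
  refine Finset.sum_congr rfl fun i _ => ?_
  simp only [key]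
  rw [fderiv_fun_neg, neg_apply,
    key (fun z => fderiv ℝ f z (EuclideanSpace.single i 1)), neg_neg]

/-- At an interior maximum the Laplacian is nonpositive. -/
lemma laplacian_nonpos_of_isLocalMax {f : 𝔼 → ℝ} {x : 𝔼} (hf : ContDiffAt ℝ 2 f x)
    (hmax : IsLocalMax f x) : laplacian n f x ≤ 0 := by
  refine Finset.sum_nonpos fun i _ => ?_
  set v : 𝔼 := EuclideanSpace.single i 1
  by_contra! hpos
  set g : ℝ → ℝ := fun t => f (x + t • v) with hg
  have hline (t : ℝ) : HasDerivAt (fun s : ℝ => x + s • v) v t := by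
    simpa using ((hasDerivAt_id t).smul_const v).const_add x
  have hcont : Tendsto (fun s : ℝ => x + s • v) (𝓝 0) (𝓝 x) := by
    simpa using (hline 0).continuousAt.tendsto
  have hg' : deriv g =ᶠ[𝓝 0] fun t => fderiv ℝ f (x + t • v) v := by
    filter_upwards [hcont.eventually hf.eventually_differentiableAt_two] with t ht
    exact (ht.hasFDerivAt.comp_hasDerivAt t (hline t)).deriv
  have hd0 : fderiv ℝ f x = 0 := hmax.fderiv_eq_zero
  have hg'0 : deriv g 0 = 0 := by
    rw [hg'.eq_of_nhds]
    simp [hd0]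
  have hg'' : deriv (deriv g) 0 = fderiv ℝ (fun y => fderiv ℝ f y v) x v := by
    rw [hg'.deriv_eq]
    have h1 := (hf.differentiableAt_fderiv_apply v).hasFDerivAt
    have h2 := HasFDerivAt.comp_hasDerivAt_of_eq (0 : ℝ) h1 (hline 0) (by simp)
    exact h2.deriv
  have hgc : ContinuousAt g 0 := by
    have : ContinuousAt f (x + (0 : ℝ) • v) := by simpa using hf.continuousAt
    exact ContinuousAt.comp (g := f) this (hline 0).continuousAt
  have hmin : IsLocalMin g 0 := isLocalMin_of_deriv_deriv_pos (by rw [hg'']; exact hpos) hg'0 hgc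
  have hmaxg : ∀ᶠ t in 𝓝 (0 : ℝ), g t ≤ g 0 := by
    filter_upwards [hcont.eventually hmax] with t ht
    simpa [hg] using ht
  have hconst : g =ᶠ[𝓝 0] fun _ => g 0 := by
    filter_upwards [hmin, hmaxg] with t h1 h2 using le_antisymm h2 h1
  have : deriv g =ᶠ[𝓝 0] fun _ => 0 := by
    filter_upwards [hconst.eventuallyEq_nhds] with t ht
    rw [ht.deriv_eq]
    simp
  rw [← hg'', this.deriv_eq] at hpos
  simp at hpos

lemma fderiv_norm_sub_sq_apply (e x v : 𝔼) :
    fderiv ℝ (fun z : 𝔼 => ‖z - e‖ ^ 2) x v = 2 * inner ℝ (x - e) v := by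
  have h := ((hasFDerivAt_id x).sub_const e).norm_sq
  have h' := h.fderiv
  simp only [id] at h'
  rw [h']
  simp [inner_sub_left]

lemma hasFDerivAt_inner_sub_left (e x v : 𝔼) :
    HasFDerivAt (fun z : 𝔼 => inner ℝ (z - e) v) (innerSL ℝ v) x := by
  have h := ((innerSL ℝ v).hasFDerivAt (x := x - e)).comp x ((hasFDerivAt_id x).sub_const e)
  refine h.congr_of_eventuallyEq (Eventually.of_forall fun z => ?_)
  simp [real_inner_comm]

lemma laplacian_norm_sub_sq (e x : 𝔼) :
    laplacian n (fun z : 𝔼 => ‖z - e‖ ^ 2) x = 2 * n := by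
  have (i : Fin n) : fderiv ℝ (fun y => fderiv ℝ (fun z : 𝔼 => ‖z - e‖ ^ 2) y
      (EuclideanSpace.single i 1)) x (EuclideanSpace.single i 1) = 2 := by
    simp only [fderiv_norm_sub_sq_apply]
    rw [((hasFDerivAt_inner_sub_left e x _).const_mul 2).fderiv]
    simp
  simp [laplacian, this, mul_comm]

lemma contDiff_norm_sub_sq (e : 𝔼) : ContDiff ℝ 2 (fun z : 𝔼 => ‖z - e‖ ^ 2) :=
  (contDiff_id.sub contDiff_const).norm_sq ℝ

lemma contDiffAt_log_norm_sub_sq {e x : 𝔼} (hx : x ≠ e) :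
    ContDiffAt ℝ 2 (fun z : 𝔼 => Real.log (‖z - e‖ ^ 2)) x :=
  (contDiff_norm_sub_sq e).contDiffAt.log (by simpa [sub_eq_zero] using hx)

lemma laplacian_log_norm_sub_sq {e x : 𝔼} (hx : x ≠ e) :
    laplacian n (fun z : 𝔼 => Real.log (‖z - e‖ ^ 2)) x = (2 * n - 4) / ‖x - e‖ ^ 2 := by
  have hq : ‖x - e‖ ^ 2 ≠ 0 := by simpa [sub_eq_zero] using hx
  have hdq (y : 𝔼) : DifferentiableAt ℝ (fun z : 𝔼 => ‖z - e‖ ^ 2) y :=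
    (contDiff_norm_sub_sq e).contDiffAt.differentiableAt (by norm_num)
  have key (i : Fin n) : fderiv ℝ (fun y => fderiv ℝ (fun z : 𝔼 => Real.log (‖z - e‖ ^ 2)) y
      (EuclideanSpace.single i 1)) x (EuclideanSpace.single i 1)
      = 2 / ‖x - e‖ ^ 2 - 4 / (‖x - e‖ ^ 2) ^ 2 * (x - e) i ^ 2 := by
    set v : 𝔼 := EuclideanSpace.single i 1
    have h1 : (fun y => fderiv ℝ (fun z : 𝔼 => Real.log (‖z - e‖ ^ 2)) y v) =ᶠ[𝓝 x]
        fun y => (‖y - e‖ ^ 2)⁻¹ * (2 * inner ℝ (y - e) v) := by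
      filter_upwards [isOpen_ne.mem_nhds hx] with y hy
      rw [fderiv.log (hdq y) (by simpa [sub_eq_zero] using hy), ← fderiv_norm_sub_sq_apply]
      rfl
    have h2 : HasFDerivAt (fun y => (‖y - e‖ ^ 2)⁻¹ * (2 * inner ℝ (y - e) v)) _ x :=
      ((hasDerivAt_inv hq).comp_hasFDerivAt x (hdq x).hasFDerivAt).mul
        ((hasFDerivAt_inner_sub_left e x v).const_mul 2)
    rw [h1.fderiv_eq, h2.fderiv]
    simp only [add_apply, smul_apply,
      fderiv_norm_sub_sq_apply, smul_eq_mul, innerSL_apply_apply, Function.comp_apply]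
    have hin : inner ℝ (x - e) v = (x - e) i := by simp [v, EuclideanSpace.inner_single_right]
    have hvv : inner ℝ v v = (1 : ℝ) := by simp [v]
    rw [hin, hvv]
    field_simp
    ring
  simp only [laplacian, key, Finset.sum_sub_distrib, ← Finset.mul_sum]
  rw [← EuclideanSpace.real_norm_sq_eq]
  simp only [Finset.sum_const, Finset.card_univ, Fintype.card_fin, nsmul_eq_mul]
  field_simp

/-! ### The parabolic maximum principle -/

lemma HasDerivAt.nonneg_of_eventually_le_left {f : ℝ → ℝ} {d t : ℝ} (hf : HasDerivAt f d t)
    (h : ∀ᶠ s in 𝓝[<] t, f s ≤ f t) : 0 ≤ d := by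
  refine ge_of_tendsto
    (hf.tendsto_slope.mono_left (nhdsWithin_mono t fun s (hs : s ∈ Iio t) => ne_of_lt hs)) ?_
  filter_upwards [h, self_mem_nhdsWithin] with s hs hst
  rw [slope_def_field]
  exact div_nonneg_of_nonpos (by linarith) (by linarith [mem_Iio.1 hst])

/-- A strict subsolution of the heat equation, continuous up to the boundary of a compact cylinder
and nonpositive on the parabolic boundary, is nonpositive. -/
lemma nonpos_of_strict_subcaloric {K : Set 𝔼} (hK : IsCompact K) {a b : ℝ} {v : 𝔼 → ℝ → ℝ}
    (hv : Continuous fun p : K × Icc a b => v p.1 p.2)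
    (hinit : ∀ z ∈ K, v z a ≤ 0)
    (hbdry : ∀ z ∈ K, z ∉ interior K → ∀ τ ∈ Icc a b, v z τ ≤ 0)
    (hC2 : ∀ z ∈ interior K, ∀ τ ∈ Ioc a b, ContDiffAt ℝ 2 (fun y => v y τ) z)
    (hsub : ∀ z ∈ interior K, ∀ τ ∈ Ioc a b,
      ∃ d < laplacian n (fun y => v y τ) z, HasDerivAt (v z) d τ) :
    ∀ z ∈ K, ∀ τ ∈ Icc a b, v z τ ≤ 0 := by
  intro z hz τ hτ
  have : CompactSpace K := isCompact_iff_compactSpace.1 hK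
  obtain ⟨⟨⟨z₁, hz₁⟩, ⟨τ₁, hτ₁⟩⟩, -, hmax⟩ :=
    isCompact_univ.exists_isMaxOn ⟨(⟨z, hz⟩, ⟨τ, hτ⟩), mem_univ _⟩ hv.continuousOn
  have hle (y : 𝔼) (hy : y ∈ K) (s : ℝ) (hs : s ∈ Icc a b) : v y s ≤ v z₁ τ₁ :=
    hmax (mem_univ ((⟨y, hy⟩, ⟨s, hs⟩) : K × Icc a b))
  refine (hle z hz τ hτ).trans ?_
  by_contra! hpos
  have hτ₁' : τ₁ ∈ Ioc a b := by
    refine ⟨lt_of_le_of_ne hτ₁.1 ?_, hτ₁.2⟩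
    rintro rfl
    exact (hinit z₁ hz₁).not_gt hpos
  have h_int : z₁ ∈ interior K := by
    by_contra h
    exact (hbdry z₁ hz₁ h τ₁ hτ₁).not_gt hpos
  obtain ⟨d, hd, hder⟩ := hsub z₁ h_int τ₁ hτ₁'
  have hlap : laplacian n (fun y => v y τ₁) z₁ ≤ 0 := by
    refine laplacian_nonpos_of_isLocalMax (hC2 z₁ h_int τ₁ hτ₁') ?_
    filter_upwards [mem_interior_iff_mem_nhds.1 h_int] with y hy using hle y hy τ₁ hτ₁
  have hnonneg : 0 ≤ d := by
    refine hder.nonneg_of_eventually_le_left ?_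
    filter_upwards [Ioo_mem_nhdsLT hτ₁'.1] with s hs
    exact hle z₁ hz₁ s ⟨hs.1.le, hs.2.le.trans hτ₁.2⟩
  linarith

/-! ### Second differences -/

/-- A compactly supported `C²` function has quadratically bounded second differences. -/
lemma exists_abs_second_difference_le {f : 𝔼 → ℝ} (hf : ContDiff ℝ 2 f)
    (hc : HasCompactSupport f) :
    ∃ k : ℝ, ∀ y h, |f (y + h) + f (y - h) - 2 * f y| ≤ k * ‖h‖ ^ 2 := by
  obtain ⟨C, hC⟩ := ContDiff.lipschitzWith_of_hasCompactSupport (hc.fderiv ℝ)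
    (hf.fderiv_right (m := 1) (by norm_num)) (by norm_num)
  refine ⟨2 * C, fun y h => ?_⟩
  have hd := hf.differentiable (by norm_num)
  have hder (x : 𝔼) : HasFDerivAt (fun x => f (y + x) + f (y - x))
      (fderiv ℝ f (y + x) - fderiv ℝ f (y - x)) x := by
    have h1 := (hd (y + x)).hasFDerivAt.comp x ((hasFDerivAt_id x).const_add y)
    have h2 := (hd (y - x)).hasFDerivAt.comp x ((hasFDerivAt_id x).const_sub y)
    refine (h1.add h2).congr_fderiv ?_
    ext v
    simp [sub_eq_add_neg]
  have hbound (x : 𝔼) (hx : x ∈ Metric.closedBall (0 : 𝔼) ‖h‖) :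
      ‖fderiv ℝ f (y + x) - fderiv ℝ f (y - x)‖ ≤ 2 * C * ‖h‖ := by
    have h1 := hC.dist_le_mul (y + x) (y - x)
    rw [dist_eq_norm, dist_eq_norm] at h1
    have h2 : (y + x) - (y - x) = (2 : ℝ) • x := by
      rw [two_smul]
      abel
    rw [h2, norm_smul, Real.norm_ofNat] at h1
    have h3 : ‖x‖ ≤ ‖h‖ := by simpa using hx
    have h4 := mul_le_mul_of_nonneg_left h3 C.coe_nonneg
    linarith
  have := (convex_closedBall (0 : 𝔼) ‖h‖).norm_image_sub_le_of_norm_hasFDerivWithin_le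
    (fun x _ => (hder x).hasFDerivWithinAt) hbound (x := 0) (y := h) (by simp) (by simp)
  simp only [add_zero, sub_zero, Real.norm_eq_abs] at this
  rw [show f (y + h) + f (y - h) - 2 * f y = f (y + h) + f (y - h) - (f y + f y) by ring]
  calc _ ≤ _ := this
    _ = _ := by ring

/-- A quadratic upper bound on the second differences bounds the Laplacian. -/
lemma laplacian_le_of_second_difference_le {f : 𝔼 → ℝ} (hf : ContDiff ℝ 2 f) {k : ℝ} {y : 𝔼}
    (h : ∀ h, f (y + h) + f (y - h) - 2 * f y ≤ k * ‖h‖ ^ 2) :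
    laplacian n f y ≤ n * k := by
  have hsq := contDiff_norm_sub_sq (0 : 𝔼)
  simp only [sub_zero] at hsq
  have h1 : ContDiff ℝ 2 fun z => f (y + z) := hf.comp (contDiff_const.add contDiff_id)
  have h2 : ContDiff ℝ 2 fun z => f (y - z) := hf.comp (contDiff_const.sub contDiff_id)
  have h3 : ContDiff ℝ 2 fun z : 𝔼 => k * ‖z‖ ^ 2 := contDiff_const.mul hsq
  have hmax : IsLocalMax (fun z => f (y + z) + f (y - z) - k * ‖z‖ ^ 2) 0 := by
    refine Eventually.of_forall fun z => ?_
    have := h z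
    simp only [add_zero, sub_zero, norm_zero]
    linarith
  have hlap := laplacian_nonpos_of_isLocalMax ((h1.add h2).sub h3).contDiffAt hmax
  rw [laplacian_sub (h1.add h2).contDiffAt h3.contDiffAt,
    laplacian_add h1.contDiffAt h2.contDiffAt, laplacian_const_mul k hsq.contDiffAt,
    laplacian_comp_const_add, laplacian_comp_const_sub] at hlap
  have := laplacian_norm_sub_sq (0 : 𝔼) 0
  simp only [sub_zero, add_zero] at this hlap
  rw [this] at hlap
  linarith

lemma abs_laplacian_le_of_abs_second_difference_le {f : 𝔼 → ℝ} (hf : ContDiff ℝ 2 f) {k : ℝ}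
    {y : 𝔼} (h : ∀ h, |f (y + h) + f (y - h) - 2 * f y| ≤ k * ‖h‖ ^ 2) :
    |laplacian n f y| ≤ n * k := by
  refine abs_le.2 ⟨?_, laplacian_le_of_second_difference_le hf fun z => (abs_le.1 (h z)).2⟩
  have hneg := laplacian_le_of_second_difference_le (f := fun z => -1 * f z)
    (contDiff_const.mul hf) (k := k) (y := y) fun z => by linarith [(abs_le.1 (h z)).1]
  rw [laplacian_const_mul _ hf.contDiffAt] at hneg
  linarith

/-! ### Mollification in space -/

/-- The convolution `∫ η(t) f(z - t) dt`. -/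
noncomputable def mollify (η f : EuclideanSpace ℝ (Fin n) → ℝ) (z : EuclideanSpace ℝ (Fin n)) : ℝ :=
  ∫ t, η t * f (z - t)

lemma mollify_eq_convolution (η f : 𝔼 → ℝ) :
    mollify η f = convolution η f (ContinuousLinearMap.mul ℝ ℝ) volume := rfl

lemma mollify_comm (η f : 𝔼 → ℝ) : mollify η f = mollify f η := by
  ext z
  simp only [mollify]
  rw [← integral_sub_left_eq_self _ volume z]
  simp [mul_comm]

lemma integrable_mollify {η f : 𝔼 → ℝ} (hη : LocallyIntegrable η) (hf : Continuous f)
    (hc : HasCompactSupport f) (z : 𝔼) : Integrable fun t => η t * f (z - t) :=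
  hc.convolutionExists_right (ContinuousLinearMap.mul ℝ ℝ) hη hf z

lemma contDiff_mollify {η f : 𝔼 → ℝ} (hη : LocallyIntegrable η) (hf : ContDiff ℝ 2 f)
    (hc : HasCompactSupport f) : ContDiff ℝ 2 (mollify η f) :=
  hc.contDiff_convolution_right (n := 2) (ContinuousLinearMap.mul ℝ ℝ) hη hf

lemma fderiv_mollify_apply {η f : 𝔼 → ℝ} (hη : LocallyIntegrable η) (hf : ContDiff ℝ 1 f)
    (hc : HasCompactSupport f) (z v : 𝔼) :
    fderiv ℝ (mollify η f) z v = mollify η (fun y => fderiv ℝ f y v) z := by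
  rw [mollify_eq_convolution,
    (hc.hasFDerivAt_convolution_right (ContinuousLinearMap.mul ℝ ℝ) hη hf z).fderiv,
    convolution_precompR_apply _ hη (hc.fderiv ℝ) (hf.continuous_fderiv one_ne_zero)]
  rfl

lemma laplacian_mollify {η f : 𝔼 → ℝ} (hη : LocallyIntegrable η) (hf : ContDiff ℝ 2 f)
    (hc : HasCompactSupport f) (z : 𝔼) :
    laplacian n (mollify η f) z = mollify η (laplacian n f) z := by
  have h1 (v : 𝔼) : ContDiff ℝ 1 fun y => fderiv ℝ f y v :=
    (hf.fderiv_right (m := 1) (by norm_num)).clm_apply contDiff_const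
  have h2 (v : 𝔼) : HasCompactSupport fun y => fderiv ℝ f y v := hc.fderiv_apply ℝ v
  have h3 (v : 𝔼) : Continuous fun y => fderiv ℝ (fun y => fderiv ℝ f y v) y v :=
    ((h1 v).continuous_fderiv one_ne_zero).clm_apply continuous_const
  simp only [laplacian, fderiv_mollify_apply hη (hf.of_le one_le_two) hc]
  calc _ = ∑ i : Fin n, mollify η (fun y => fderiv ℝ (fun y => fderiv ℝ f y
        (EuclideanSpace.single i 1)) y (EuclideanSpace.single i 1)) z :=
        Finset.sum_congr rfl fun i _ => fderiv_mollify_apply hη (h1 _) (h2 _) z _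
    _ = _ := by
      simp only [mollify]
      rw [← integral_finsetSum]
      · simp only [_root_.laplacian, Finset.mul_sum]
      intro i _
      exact integrable_mollify hη (h3 _) ((h2 _).fderiv_apply ℝ _) z

lemma ContDiff.continuous_laplacian {f : 𝔼 → ℝ} (hf : ContDiff ℝ 2 f) :
    Continuous (laplacian n f) := by
  refine continuous_finsetSum _ fun i _ => ?_
  have h1 : ContDiff ℝ 1 fun y => fderiv ℝ f y (EuclideanSpace.single i 1) :=
    (hf.fderiv_right (m := 1) (by norm_num)).clm_apply contDiff_const
  exact (h1.continuous_fderiv one_ne_zero).clm_apply continuous_const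

lemma HasCompactSupport.laplacian {f : 𝔼 → ℝ} (hc : HasCompactSupport f) :
    HasCompactSupport (laplacian n f) := by
  refine hc.mono' fun x hx => ?_
  by_contra hxs
  refine hx ?_
  rw [laplacian_congr (notMem_tsupport_iff_eventuallyEq.1 hxs)]
  exact laplacian_const 0 x

/-- Averages against a normalized bump function obey any pointwise bound valid on its support. -/
lemma abs_mollify_normed_le (b : ContDiffBump (0 : 𝔼)) {f : 𝔼 → ℝ} {z : 𝔼} {C : ℝ}
    (hC : ∀ t ∈ Metric.ball (0 : 𝔼) b.rOut, |f (z - t)| ≤ C) :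
    |mollify (b.normed volume) f z| ≤ C := by
  have h : ‖∫ t, b.normed volume t * f (z - t)‖ ≤ ∫ t, b.normed volume t * C := by
    refine norm_integral_le_of_norm_le (b.integrable_normed.mul_const C)
      (Eventually.of_forall fun t => ?_)
    rw [norm_mul, Real.norm_of_nonneg (b.nonneg_normed t), Real.norm_eq_abs]
    by_cases ht : t ∈ Metric.ball (0 : 𝔼) b.rOut
    · exact mul_le_mul_of_nonneg_left (hC t ht) (b.nonneg_normed t)
    · rw [← b.support_normed_eq (μ := volume), Function.notMem_support] at ht
      simp [ht]
  rwa [integral_mul_const, b.integral_normed, one_mul] at h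

/-- Joint continuity of mollifications of a bounded family that is continuous in the parameter. -/
lemma continuous_mollify_uncurry {η : 𝔼 → ℝ} (hη : Continuous η) (hηc : HasCompactSupport η)
    {u : 𝔼 → ℝ → ℝ} {S : Set 𝔼} (hS : IsCompact S) {M : ℝ}
    (hu : ∀ τ, Continuous fun z => u z τ) (huτ : ∀ z, Continuous (u z))
    (huS : ∀ τ, ∀ z ∉ S, u z τ = 0) (huM : ∀ z τ, |u z τ| ≤ M) :
    Continuous fun p : 𝔼 × ℝ => mollify η (fun z => u z p.2) p.1 := by
  obtain ⟨C, hC⟩ := hηc.exists_bound_of_continuous hη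
  have heq : (fun p : 𝔼 × ℝ => mollify η (fun z => u z p.2) p.1)
      = fun p => ∫ x, u x p.2 * η (p.1 - x) := by
    ext p
    rw [mollify_comm]
    rfl
  rw [heq]
  refine continuous_of_dominated (bound := S.indicator fun _ => M * C) (fun p => ?_) (fun p => ?_)
    ?_ ?_
  · exact ((hu p.2).mul (hη.comp (continuous_const.sub continuous_id))).aestronglyMeasurable
  · refine Eventually.of_forall fun x => ?_
    by_cases hx : x ∈ S
    · rw [indicator_of_mem hx, norm_mul]
      exact mul_le_mul (huM x p.2) (hC _) (norm_nonneg _) ((abs_nonneg _).trans (huM x p.2))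
    · simp [huS p.2 x hx, hx]
  · exact (integrable_indicator_iff hS.measurableSet).2
      (integrableOn_const hS.measure_lt_top.ne)
  · refine Eventually.of_forall fun x => ?_
    exact ((huτ x).comp continuous_snd).mul (hη.comp (continuous_fst.sub continuous_const))

/-! ### Functions of separate regularity solving the heat equation on an open set -/

/-- A bounded function, `C²` in space with a fixed compact support and continuous in time, which
solves the heat equation pointwise on `Ω × (-∞, 0)`. No joint regularity is required. -/
structure CutoffCaloric (u : EuclideanSpace ℝ (Fin n) → ℝ → ℝ) (S : Set (EuclideanSpace ℝ (Fin n)))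
    (M : ℝ) (Ω : Set (EuclideanSpace ℝ (Fin n))) : Prop where
  isCompact : IsCompact S
  contDiff : ∀ τ, ContDiff ℝ 2 fun z => u z τ
  eq_zero : ∀ τ, ∀ z ∉ S, u z τ = 0
  bound : ∀ z τ, |u z τ| ≤ M
  continuous_time : ∀ z, Continuous (u z)
  heat : ∀ z ∈ Ω, ∀ τ < 0, HasDerivAt (u z) (laplacian n (fun y => u y τ) z) τ

/-- All bump mollifications of `u` supported in `Ω` solve the heat equation at time `τ`. -/
def MollifiedHeat (u : EuclideanSpace ℝ (Fin n) → ℝ → ℝ) (Ω : Set (EuclideanSpace ℝ (Fin n)))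
    (τ : ℝ) : Prop :=
  ∀ (b : ContDiffBump (0 : EuclideanSpace ℝ (Fin n))) (z : EuclideanSpace ℝ (Fin n)),
    Metric.closedBall z b.rOut ⊆ Ω →
      HasDerivAt (fun s => mollify (b.normed volume) (fun y => u y s) z)
        (laplacian n (mollify (b.normed volume) fun y => u y τ) z) τ

lemma tendsto_mollify_of_rOut {ι : Type*} {l : Filter ι} {b : ι → ContDiffBump (0 : 𝔼)}
    (hb : Tendsto (fun i => (b i).rOut) l (𝓝 0)) {f : 𝔼 → ℝ} (hf : Continuous f) (z : 𝔼) :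
    Tendsto (fun i => mollify ((b i).normed volume) f z) l (𝓝 (f z)) :=
  ContDiffBump.convolution_tendsto_right_of_continuous hb hf z

lemma exists_bumps_tendsto_zero (r : ℝ) (hr : 0 < r) :
    ∃ b : ℕ → ContDiffBump (0 : 𝔼), Tendsto (fun i => (b i).rOut) atTop (𝓝 0) ∧
      ∀ i, (b i).rOut ≤ r := by
  refine ⟨fun i => ⟨r * (1 / ((i : ℝ) + 1)) / 2, r * (1 / ((i : ℝ) + 1)), by positivity,
    half_lt_self (by positivity)⟩, ?_, fun i => ?_⟩
  · simpa using tendsto_one_div_add_atTop_nhds_zero_nat.const_mul r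
  · have : (1 : ℝ) / ((i : ℝ) + 1) ≤ 1 := by
      rw [div_le_one (by positivity)]
      linarith [(Nat.cast_nonneg i : (0 : ℝ) ≤ i)]
    exact mul_le_of_le_one_right hr.le this

namespace CutoffCaloric

variable {u : EuclideanSpace ℝ (Fin n) → ℝ → ℝ} {S Ω : Set (EuclideanSpace ℝ (Fin n))} {M : ℝ}

lemma hasCompactSupport (h : CutoffCaloric u S M Ω) (τ : ℝ) : HasCompactSupport fun z => u z τ :=
  HasCompactSupport.intro h.isCompact fun z hz => h.eq_zero τ z hz

lemma contDiff_mollify (h : CutoffCaloric u S M Ω) (b : ContDiffBump (0 : 𝔼)) (τ : ℝ) :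
    ContDiff ℝ 2 (mollify (b.normed volume) fun y => u y τ) :=
  _root_.contDiff_mollify b.continuous_normed.locallyIntegrable (h.contDiff τ)
    (h.hasCompactSupport τ)

lemma continuous_mollify (h : CutoffCaloric u S M Ω) (b : ContDiffBump (0 : 𝔼)) :
    Continuous fun p : 𝔼 × ℝ => mollify (b.normed volume) (fun y => u y p.2) p.1 :=
  continuous_mollify_uncurry b.continuous_normed b.hasCompactSupport_normed h.isCompact
    (fun τ => (h.contDiff τ).continuous) h.continuous_time h.eq_zero h.bound

lemma continuous_mollify_time (h : CutoffCaloric u S M Ω) (b : ContDiffBump (0 : 𝔼)) (z : 𝔼) :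
    Continuous fun τ => mollify (b.normed volume) (fun y => u y τ) z :=
  (h.continuous_mollify b).comp (continuous_const.prodMk continuous_id)

lemma continuous_laplacian_mollify (h : CutoffCaloric u S M Ω) (b : ContDiffBump (0 : 𝔼)) (z : 𝔼) :
    Continuous fun τ => laplacian n (mollify (b.normed volume) fun y => u y τ) z := by
  have hη : ContDiff ℝ 2 (b.normed (volume : Measure 𝔼)) := b.contDiff_normed (n := 2)
  have heq (τ : ℝ) : laplacian n (mollify (b.normed volume) fun y => u y τ) z
      = mollify (laplacian n (b.normed volume)) (fun y => u y τ) z := by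
    rw [mollify_comm, laplacian_mollify (h.contDiff τ).continuous.locallyIntegrable hη
      b.hasCompactSupport_normed, mollify_comm]
  simp only [heq]
  exact (continuous_mollify_uncurry hη.continuous_laplacian b.hasCompactSupport_normed.laplacian
    h.isCompact (fun τ => (h.contDiff τ).continuous) h.continuous_time h.eq_zero h.bound).comp
    (continuous_const.prodMk continuous_id)

lemma abs_mollify_le (h : CutoffCaloric u S M Ω) (b : ContDiffBump (0 : 𝔼)) (z : 𝔼) (τ : ℝ) :
    |mollify (b.normed volume) (fun y => u y τ) z| ≤ M :=
  abs_mollify_normed_le b fun _ _ => h.bound _ _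

lemma abs_second_difference_mollify_le (h : CutoffCaloric u S M Ω) (b : ContDiffBump (0 : 𝔼))
    {k a : ℝ} (hk : ∀ y x, |u (y + x) a + u (y - x) a - 2 * u y a| ≤ k * ‖x‖ ^ 2) (y x : 𝔼) :
    |mollify (b.normed volume) (fun y => u y a) (y + x)
      + mollify (b.normed volume) (fun y => u y a) (y - x)
      - 2 * mollify (b.normed volume) (fun y => u y a) y| ≤ k * ‖x‖ ^ 2 := by
  have h_int (z : 𝔼) := integrable_mollify (b.continuous_normed (μ := volume)).locallyIntegrable
    (h.contDiff a).continuous (h.hasCompactSupport a) z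
  have hsum : Integrable fun t => b.normed volume t * u (y + x - t) a
      + b.normed volume t * u (y - x - t) a := (h_int (y + x)).add (h_int (y - x))
  have heq : mollify (b.normed volume) (fun y => u y a) (y + x)
      + mollify (b.normed volume) (fun y => u y a) (y - x)
      - 2 * mollify (b.normed volume) (fun y => u y a) y
      = mollify (b.normed volume) (fun w => u (w + x) a + u (w - x) a - 2 * u w a) y := by
    simp only [mollify]
    rw [← integral_add (h_int _) (h_int _), ← integral_const_mul,
      ← integral_sub hsum ((h_int _).const_mul 2)]
    congr 1
    ext t
    rw [show y + x - t = y - t + x by abel, show y - x - t = y - t - x by abel]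
    ring
  rw [heq]
  exact abs_mollify_normed_le b fun t _ => hk (y - t) x

/-- The growth of a mollification over a time interval on which it solves the heat equation is
controlled by the second differences at the initial time. -/
lemma abs_mollify_sub_le (h : CutoffCaloric u S M Ω) (b : ContDiffBump (0 : 𝔼)) {y : 𝔼}
    {r k a c : ℝ} (hr : 0 < r) (hball : Metric.closedBall y (r + b.rOut) ⊆ Ω) (hk0 : 0 ≤ k)
    (hk : ∀ y x, |u (y + x) a + u (y - x) a - 2 * u y a| ≤ k * ‖x‖ ^ 2)
    (hheat : ∀ τ ∈ Ioo a c, MollifiedHeat u Ω τ) {τ : ℝ} (hτ : τ ∈ Ico a c) :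
    |mollify (b.normed volume) (fun x => u x τ) y - mollify (b.normed volume) (fun x => u x a) y|
      ≤ (2 * n * (k + 2 * M / r ^ 2) + 1) * (τ - a) := by
  set U : 𝔼 → ℝ → ℝ := fun z τ => mollify (b.normed volume) (fun x => u x τ) z with hU
  have hM : 0 ≤ M := (abs_nonneg _).trans (h.bound y a)
  set K : ℝ := k + 2 * M / r ^ 2 with hK
  have hkK : k ≤ K := by
    rw [hK]
    have : 0 ≤ 2 * M / r ^ 2 := by positivity
    linarith
  have hKr : 2 * M ≤ K * r ^ 2 := by
    rw [hK, add_mul, div_mul_cancel₀ _ (by positivity)]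
    have : 0 ≤ k * r ^ 2 := by positivity
    linarith
  have hUM (z : 𝔼) (s : ℝ) : |U z s| ≤ M := h.abs_mollify_le b z s
  have hdom (z : 𝔼) (hz : ‖z‖ < r) : Metric.closedBall (y + z) b.rOut ⊆ Ω := by
    refine (Metric.closedBall_subset_closedBall' ?_).trans hball
    rw [dist_self_add_left]
    linarith
  have key (σ : ℝ) (hσ : |σ| = 1) : σ * (U y τ - U y a) ≤ (2 * n * K + 1) * (τ - a) := by
    set v : 𝔼 → ℝ → ℝ := fun z s => σ / 2 * (U (y + z) s + U (y - z) s) - K * ‖z‖ ^ 2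
      - (σ * U y a + (2 * n * K + 1) * (s - a)) with hv
    have hsq := contDiff_norm_sub_sq (0 : 𝔼)
    have hlapsq := laplacian_norm_sub_sq (0 : 𝔼)
    simp only [sub_zero] at hsq hlapsq
    have h1 (s : ℝ) : ContDiff ℝ 2 fun z => U (y + z) s :=
      (h.contDiff_mollify b s).comp (contDiff_const.add contDiff_id)
    have h2 (s : ℝ) : ContDiff ℝ 2 fun z => U (y - z) s :=
      (h.contDiff_mollify b s).comp (contDiff_const.sub contDiff_id)
    have h3 (s : ℝ) : ContDiff ℝ 2 fun z => σ / 2 * (U (y + z) s + U (y - z) s) :=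
      contDiff_const.mul ((h1 s).add (h2 s))
    have h4 : ContDiff ℝ 2 fun z : 𝔼 => K * ‖z‖ ^ 2 := contDiff_const.mul hsq
    have hlap (s : ℝ) (z : 𝔼) : laplacian n (fun z => v z s) z
        = σ / 2 * (laplacian n (fun w => U w s) (y + z) + laplacian n (fun w => U w s) (y - z))
          - K * (2 * n) := by
      rw [hv, laplacian_sub ((h3 s).sub h4).contDiffAt contDiffAt_const, laplacian_const,
        laplacian_sub (h3 s).contDiffAt h4.contDiffAt,
        laplacian_const_mul _ ((h1 s).add (h2 s)).contDiffAt,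
        laplacian_add (h1 s).contDiffAt (h2 s).contDiffAt,
        laplacian_const_mul _ hsq.contDiffAt, hlapsq,
        laplacian_comp_const_add (fun w => U w s), laplacian_comp_const_sub (fun w => U w s),
        sub_zero]
    have hUc : Continuous fun p : 𝔼 × ℝ => U p.1 p.2 := h.continuous_mollify b
    have habs (x : ℝ) : σ * x ≤ |x| := by
      simpa [abs_mul, hσ] using le_abs_self (σ * x)
    have hmax := nonpos_of_strict_subcaloric (isCompact_closedBall (0 : 𝔼) r) (a := a) (b := τ)
      (v := v) ?_ ?_ ?_ ?_ ?_ 0 (by simp [hr.le]) τ ⟨hτ.1, le_rfl⟩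
    · simp only [hv, add_zero, sub_zero, norm_zero] at hmax
      linarith
    · have e1 : Continuous fun p : Metric.closedBall (0 : 𝔼) r × Icc a τ =>
          U (y + p.1) p.2 := hUc.comp (f := fun p : Metric.closedBall (0 : 𝔼) r × Icc a τ =>
            ((y + p.1, p.2) : 𝔼 × ℝ)) (by fun_prop)
      have e2 : Continuous fun p : Metric.closedBall (0 : 𝔼) r × Icc a τ =>
          U (y - p.1) p.2 := hUc.comp (f := fun p : Metric.closedBall (0 : 𝔼) r × Icc a τ =>
            ((y - p.1, p.2) : 𝔼 × ℝ)) (by fun_prop)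
      have e3 : Continuous fun p : Metric.closedBall (0 : 𝔼) r × Icc a τ =>
        K * ‖(p.1 : 𝔼)‖ ^ 2 := by fun_prop
      have e4 : Continuous fun p : Metric.closedBall (0 : 𝔼) r × Icc a τ =>
        σ * U y a + (2 * n * K + 1) * ((p.2 : ℝ) - a) := by fun_prop
      exact (((e1.add e2).const_mul (σ / 2)).sub e3).sub e4
    · intro z _
      have := h.abs_second_difference_mollify_le b hk y z
      have h5 := habs (U (y + z) a + U (y - z) a - 2 * U y a)
      have h6 : k * ‖z‖ ^ 2 ≤ K * ‖z‖ ^ 2 := by gcongr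
      have h7 : 0 ≤ k * ‖z‖ ^ 2 := by positivity
      simp only [hv, sub_self, mul_zero]
      linarith
    · intro z hz hzi s hs
      have hzr : ‖z‖ = r := by
        rw [interior_closedBall _ hr.ne'] at hzi
        simp only [Metric.mem_closedBall, Metric.mem_ball, dist_zero_right, not_lt] at hz hzi
        exact le_antisymm hz hzi
      have e1 := (habs (U (y + z) s)).trans (hUM _ _)
      have e2 := (habs (U (y - z) s)).trans (hUM _ _)
      have e3 : -(σ * U y a) ≤ M := by
        have := habs (-U y a)
        rw [abs_neg] at this
        linarith [hUM y a]
      have e4 : 0 ≤ (2 * n * K + 1) * (s - a) := by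
        have : 0 ≤ s - a := by linarith [hs.1]
        have : 0 ≤ K := hk0.trans hkK
        positivity
      simp only [hv, hzr]
      linarith
    · intro z _ s _
      exact (((h3 s).sub h4).sub contDiff_const).contDiffAt
    · intro z hz s hs
      rw [interior_closedBall _ hr.ne'] at hz
      simp only [Metric.mem_ball, dist_zero_right] at hz
      have hs' : s ∈ Ioo a c := ⟨hs.1, hs.2.trans_lt hτ.2⟩
      have d1 := hheat s hs' b (y + z) (hdom z hz)
      have d2 := hheat s hs' b (y - z) (by
        rw [sub_eq_add_neg]
        exact hdom (-z) (by simpa using hz))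
      have d3 : HasDerivAt (fun s => σ * U y a + (2 * n * K + 1) * (s - a))
          ((2 * n * K + 1) * 1) s :=
        (((hasDerivAt_id s).sub_const a).const_mul _).const_add _
      refine ⟨_, ?_, (((d1.add d2).const_mul (σ / 2)).sub_const (K * ‖z‖ ^ 2)).sub d3⟩
      rw [hlap]
      linarith
  have k1 := key 1 (by simp)
  have k2 := key (-1) (by simp)
  exact abs_le.2 ⟨by linarith, by linarith⟩

lemma abs_sub_le_of_mollifiedHeat (h : CutoffCaloric u S M Ω) {y : 𝔼}
    {r k a c : ℝ} (hr : 0 < r) (hball : Metric.closedBall y (2 * r) ⊆ Ω) (hk0 : 0 ≤ k)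
    (hk : ∀ y x, |u (y + x) a + u (y - x) a - 2 * u y a| ≤ k * ‖x‖ ^ 2) (hac : a ≤ c)
    (hheat : ∀ τ ∈ Ioo a c, MollifiedHeat u Ω τ) :
    |u y c - u y a| ≤ (2 * n * (k + 2 * M / r ^ 2) + 1) * (c - a) := by
  rcases hac.eq_or_lt with rfl | hac
  · simp
  obtain ⟨b, hb, hbr⟩ := exists_bumps_tendsto_zero (n := n) r hr
  have hlt : ∀ τ ∈ Ioo a c, |u y τ - u y a| ≤ (2 * n * (k + 2 * M / r ^ 2) + 1) * (τ - a) := by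
    intro τ hτ
    have hlim (s : ℝ) := tendsto_mollify_of_rOut hb (h.contDiff s).continuous y
    refine le_of_tendsto ((hlim τ).sub (hlim a)).abs (Eventually.of_forall fun i => ?_)
    exact h.abs_mollify_sub_le (b i) hr ((Metric.closedBall_subset_closedBall
      (by linarith [hbr i])).trans hball) hk0 hk hheat (Ioo_subset_Ico_self hτ)
  have hcont : Continuous fun τ => |u y τ - u y a| := ((h.continuous_time y).sub continuous_const).abs
  have hcont' : Continuous fun τ => (2 * n * (k + 2 * M / r ^ 2) + 1) * (τ - a) := by fun_prop
  exact le_of_tendsto_of_tendsto (hcont.continuousWithinAt (s := Iio c)).tendsto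
    (hcont'.continuousWithinAt (s := Iio c)).tendsto
    (by filter_upwards [Ioo_mem_nhdsLT hac] with τ hτ using hlt τ hτ)

/-- A linear bound on the increments of `f` from points of `P` propagates across `P` if it holds
across the gaps of `P` and infinitesimally at the points of `P`. -/
lemma _root_.sub_le_of_gaps {f : ℝ → ℝ} {P : Set ℝ} {a c C : ℝ} (hf : Continuous f)
    (hP : IsClosed (P ∩ Icc a c)) (ha : a ∈ P) (hac : a ≤ c)
    (hder : ∀ s ∈ P ∩ Icc a c, ∃ d < C, HasDerivAt f d s)
    (hgap : ∀ s ∈ P ∩ Icc a c, ∀ t ∈ Icc s c, Disjoint (Ioo s t) P → f t - f s ≤ C * (t - s)) :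
    f c - f a ≤ C * (c - a) := by
  set A : Set ℝ := (P ∩ Icc a c) ∩ {s | f s - f a ≤ C * (s - a)}
  have hAc : IsClosed A := hP.inter (isClosed_le (by fun_prop) (by fun_prop))
  have haA : a ∈ A := ⟨⟨ha, le_rfl, hac⟩, by simp⟩
  have hAb : BddAbove A := ⟨c, fun s hs => hs.1.2.2⟩
  set s := sSup A
  have hsA : s ∈ A := hAc.csSup_mem ⟨a, haA⟩ hAb
  have hle (p : ℝ) (hp : p ∈ A) : p ≤ s := le_csSup hAb hp
  have hs1 : f s - f a ≤ C * (s - a) := hsA.2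
  have hsc : s ≤ c := hsA.1.2.2
  have has : a ≤ s := hsA.1.2.1
  suffices Disjoint (Ioo s c) P by
    have := hgap s hsA.1 c ⟨hsc, le_rfl⟩ this
    linarith
  rw [Set.disjoint_left]
  intro p hp hpP
  obtain ⟨d, hd, hds⟩ := hder s hsA.1
  have hslope : ∀ᶠ t in 𝓝[>] s, slope f s t < C :=
    (hds.tendsto_slope.mono_left (nhdsWithin_mono s fun t (ht : t ∈ Ioi s) =>
      ne_of_gt ht)).eventually (gt_mem_nhds hd)
  obtain ⟨q, hq, hqs⟩ := mem_nhdsGT_iff_exists_Ioo_subset.1 hslope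
  have hnear : ∀ t ∈ Ioo s q, t ≤ c → t ∉ P := by
    intro t ht htc htP
    have h1 : slope f s t < C := hqs ht
    rw [slope_def_field, div_lt_iff₀ (by linarith [ht.1])] at h1
    have : t ∈ A := ⟨⟨htP, has.trans ht.1.le, htc⟩, by
      simp only [mem_ofPred_eq]
      linarith⟩
    exact (hle t this).not_gt ht.1
  have hqp : q ≤ p := by
    by_contra! h
    exact hnear p ⟨hp.1, h⟩ hp.2.le hpP
  set B : Set ℝ := (P ∩ Icc a c) ∩ Ici q
  have hBc : IsClosed B := hP.inter isClosed_Ici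
  have hpB : p ∈ B := ⟨⟨hpP, has.trans hp.1.le, hp.2.le⟩, hqp⟩
  have hBb : BddBelow B := ⟨q, fun t ht => ht.2⟩
  set m := sInf B
  have hmB : m ∈ B := hBc.csInf_mem ⟨p, hpB⟩ hBb
  have hqm : q ≤ m := hmB.2
  have hsm : s < m := lt_of_lt_of_le hq hqm
  have hdis : Disjoint (Ioo s m) P := by
    rw [Set.disjoint_left]
    intro t ht htP
    have htc : t ≤ c := ht.2.le.trans hmB.1.2.2
    rcases lt_or_ge t q with h | h
    · exact hnear t ⟨ht.1, h⟩ htc htP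
    · exact (csInf_le hBb (⟨⟨htP, has.trans ht.1.le, htc⟩, h⟩ : t ∈ B)).not_gt ht.2
  have h2 := hgap s hsA.1 m ⟨hsm.le, hmB.1.2.2⟩ hdis
  have : m ∈ A := ⟨hmB.1, by
    simp only [mem_ofPred_eq]
    linarith⟩
  exact (hle m this).not_gt hsm

/-- A continuous function with a continuous right derivative is differentiable. -/
lemma _root_.hasDerivAt_of_continuous_right_deriv {f g : ℝ → ℝ} {l r : ℝ} (hf : Continuous f)
    (hg : Continuous g) (h : ∀ s ∈ Ioo l r, HasDerivWithinAt f (g s) (Ici s) s) {s : ℝ}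
    (hs : s ∈ Ioo l r) : HasDerivAt f (g s) s := by
  obtain ⟨p, hp⟩ := exists_between hs.1
  obtain ⟨q, hq⟩ := exists_between hs.2
  have hG (t : ℝ) : HasDerivAt (fun t => ∫ x in p..t, g x) (g t) t :=
    (hg.integral_hasStrictDerivAt p t).hasDerivAt
  have hconst := constant_of_has_deriv_right_zero (f := fun t => f t - ∫ x in p..t, g x)
    (a := p) (b := q)
    (hf.sub (continuous_iff_continuousAt.2 fun t => (hG t).continuousAt)).continuousOn
    (fun x hx => by
      rw [← sub_self (g x)]
      exact (h x ⟨hp.1.trans_le hx.1, hx.2.trans hq.2⟩).sub (hG x).hasDerivWithinAt)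
  have heq : f =ᶠ[𝓝 s] fun t => f p + ∫ x in p..t, g x := by
    filter_upwards [Ioo_mem_nhds hp.2 hq.1] with t ht
    have := hconst t ⟨ht.1.le, ht.2.le⟩
    simp only [intervalIntegral.integral_same, sub_zero] at this
    linarith
  exact ((hG s).const_add (f p)).congr_of_eventuallyEq heq

/-- Uniform one-sided Lipschitz bounds in time pass the heat equation to mollifications. -/
lemma hasDerivWithinAt_mollify (h : CutoffCaloric u S M Ω) (b : ContDiffBump (0 : 𝔼)) {z : 𝔼}
    (hz : Metric.closedBall z b.rOut ⊆ Ω) {a c C : ℝ} (ha : a < 0) (hac : a < c)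
    (hC : ∀ y ∈ Metric.closedBall z b.rOut, ∀ τ ∈ Ioo a c, |u y τ - u y a| ≤ C * (τ - a)) :
    HasDerivWithinAt (fun s => mollify (b.normed volume) (fun y => u y s) z)
      (laplacian n (mollify (b.normed volume) fun y => u y a) z) (Ici a) a := by
  have hη : LocallyIntegrable (b.normed volume) (volume : Measure 𝔼) :=
    b.continuous_normed.locallyIntegrable
  have h_int (τ : ℝ) := integrable_mollify hη (h.contDiff τ).continuous (h.hasCompactSupport τ) z
  rw [laplacian_mollify hη (h.contDiff a) (h.hasCompactSupport a), ← hasDerivWithinAt_Ioi_iff_Ici,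
    hasDerivWithinAt_iff_tendsto_slope' (by simp)]
  have hslope (τ : ℝ) : slope (fun s => mollify (b.normed volume) (fun y => u y s) z) a τ
      = ∫ t, b.normed volume t * slope (u (z - t)) a τ := by
    simp only [slope_def_field, mollify]
    rw [← integral_sub (h_int τ) (h_int a), ← integral_div]
    congr 1
    ext t
    ring
  rw [funext hslope]
  have hmem (t : 𝔼) (ht : t ∈ Metric.ball (0 : 𝔼) b.rOut) :
      z - t ∈ Metric.closedBall z b.rOut := by
    simp only [Metric.mem_ball, dist_zero_right, Metric.mem_closedBall] at ht ⊢
    rw [dist_eq_norm]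
    simpa using ht.le
  have hzero (t : 𝔼) (ht : t ∉ Metric.ball (0 : 𝔼) b.rOut) : b.normed volume t = 0 := by
    rwa [← b.support_normed_eq (μ := (volume : Measure 𝔼)), Function.notMem_support] at ht
  refine tendsto_integral_filter_of_dominated_convergence
    (fun t => b.normed volume t * C) (Eventually.of_forall fun τ => ?_) ?_
    (b.integrable_normed.mul_const C) (Eventually.of_forall fun t => ?_)
  · have hc : Continuous fun t => slope (u (z - t)) a τ := by
      simp only [slope_def_field]
      exact (((h.contDiff τ).continuous.comp (continuous_const.sub continuous_id)).sub
        ((h.contDiff a).continuous.comp (continuous_const.sub continuous_id))).div_const _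
    exact (b.continuous_normed.mul hc).aestronglyMeasurable
  · filter_upwards [Ioo_mem_nhdsGT hac] with τ hτ
    refine Eventually.of_forall fun t => ?_
    rw [norm_mul, Real.norm_of_nonneg (b.nonneg_normed t)]
    by_cases ht : t ∈ Metric.ball (0 : 𝔼) b.rOut
    · refine mul_le_mul_of_nonneg_left ?_ (b.nonneg_normed t)
      have hpos : 0 < τ - a := sub_pos.2 hτ.1
      rw [slope_def_field, Real.norm_eq_abs, abs_div, abs_of_pos hpos, div_le_iff₀ hpos]
      exact hC _ (hmem t ht) τ hτ
    · simp [hzero t ht]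
  · by_cases ht : t ∈ Metric.ball (0 : 𝔼) b.rOut
    · exact ((h.heat _ (hz (hmem t ht)) a ha).tendsto_slope.mono_left
        (nhdsWithin_mono a fun s (hs : s ∈ Ioi a) => ne_of_gt hs)).const_mul _
    · simp [hzero t ht]

/-- If the times in `(l, r)` at which the mollified heat equation may fail carry a uniform bound on
second differences, then the mollified heat equation holds throughout `(l, r)`. -/
lemma mollifiedHeat_of_bound (h : CutoffCaloric u S M Ω) (hΩ : IsOpen Ω) {P : Set ℝ} {l r k : ℝ}
    (hr0 : r ≤ 0) (hk0 : 0 ≤ k) (hPc : ∀ p q, Icc p q ⊆ Ioo l r → IsClosed (P ∩ Icc p q))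
    (hP : ∀ τ ∈ Ioo l r, τ ∉ P → MollifiedHeat u Ω τ)
    (hk : ∀ τ ∈ Ioo l r, τ ∈ P → ∀ y x, |u (y + x) τ + u (y - x) τ - 2 * u y τ| ≤ k * ‖x‖ ^ 2) :
    ∀ τ ∈ Ioo l r, MollifiedHeat u Ω τ := by
  intro τ hτ b z hz
  refine hasDerivAt_of_continuous_right_deriv (h.continuous_mollify_time b z)
    (h.continuous_laplacian_mollify b z) (fun a ha => ?_) hτ
  by_cases haP : a ∉ P
  · exact (hP a ha haP b z hz).hasDerivWithinAt
  rw [not_not] at haP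
  obtain ⟨ρ, hρ, hρΩ⟩ := (isCompact_closedBall z b.rOut).exists_cthickening_subset_open hΩ hz
  have hball (y : 𝔼) (hy : y ∈ Metric.closedBall z b.rOut) :
      Metric.closedBall y (2 * (ρ / 2)) ⊆ Ω := by
    rw [mul_div_cancel₀ _ two_ne_zero]
    exact (Metric.closedBall_subset_cthickening hy ρ).trans hρΩ
  set C : ℝ := 2 * n * (k + 2 * M / (ρ / 2) ^ 2) + 1
  have hM : 0 ≤ M := (abs_nonneg _).trans (h.bound z a)
  have hnkC : n * k < C := by
    have h1 : (0 : ℝ) ≤ n * k := by positivity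
    have h2 : (0 : ℝ) ≤ 2 * n * (2 * M / (ρ / 2) ^ 2) := by positivity
    simp only [C, mul_add]
    linarith
  refine h.hasDerivWithinAt_mollify b hz (C := C) (ha.2.trans_le hr0) ha.2 fun y hy t ht => ?_
  have hsub : Icc a t ⊆ Ioo l r := fun s hs => ⟨ha.1.trans_le hs.1, hs.2.trans_lt ht.2⟩
  have hlap (s : ℝ) (hs : s ∈ P ∩ Icc a t) : |laplacian n (fun y => u y s) y| < C :=
    (abs_laplacian_le_of_abs_second_difference_le (h.contDiff s)
      (hk s (hsub hs.2) hs.1 y)).trans_lt hnkC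
  have hgap (s : ℝ) (hs : s ∈ P ∩ Icc a t) (t' : ℝ) (ht' : t' ∈ Icc s t)
      (hdis : Disjoint (Ioo s t') P) : |u y t' - u y s| ≤ C * (t' - s) := by
    refine h.abs_sub_le_of_mollifiedHeat (half_pos hρ) (hball y hy) hk0
      (hk s (hsub hs.2) hs.1) ht'.1 fun τ hτ => ?_
    exact hP τ (hsub ⟨hs.2.1.trans hτ.1.le, hτ.2.le.trans ht'.2⟩) (Set.disjoint_left.1 hdis hτ)
  have hheat (s : ℝ) (hs : s ∈ P ∩ Icc a t) :=
    h.heat y (hz hy) s ((hsub hs.2).2.trans_le hr0)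
  refine abs_le'.2 ⟨?_, ?_⟩
  · exact sub_le_of_gaps (h.continuous_time y) (hPc a t hsub) haP ht.1.le
      (fun s hs => ⟨_, (abs_lt.1 (hlap s hs)).2, hheat s hs⟩)
      fun s hs t' ht' hdis => (abs_le'.1 (hgap s hs t' ht' hdis)).1
  · have := sub_le_of_gaps (f := fun s => -u y s) (h.continuous_time y).neg (hPc a t hsub) haP
      ht.1.le (fun s hs => ⟨_, neg_lt.1 (abs_lt.1 (hlap s hs)).1, (hheat s hs).neg⟩)
      fun s hs t' ht' hdis => by linarith [(abs_le'.1 (hgap s hs t' ht' hdis)).2]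
    linarith

/-- The mollified heat equation holds at all negative times; the exceptional closed set of times is
empty by the Baire category theorem. -/
lemma mollifiedHeat (h : CutoffCaloric u S M Ω) (hΩ : IsOpen Ω) :
    ∀ τ < 0, MollifiedHeat u Ω τ := by
  set G : Set ℝ := interior {τ | MollifiedHeat u Ω τ}
  set P : Set ℝ := Iio 0 ∩ Gᶜ
  suffices hPe : P = ∅ by
    intro τ hτ
    by_contra hcon
    have : τ ∈ P := ⟨hτ, fun hG => hcon (interior_subset hG)⟩
    simp [hPe] at this
  by_contra hne
  have hGc : IsClosed Gᶜ := isOpen_interior.isClosed_compl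
  have hlc : IsLocallyClosed P := ⟨Iio 0, Gᶜ, isOpen_Iio, hGc, rfl⟩
  have : LocallyCompactSpace P := hlc.locallyCompactSpace
  have : Nonempty P := (nonempty_iff_ne_empty.2 hne).to_subtype
  set T : ℕ → Set ℝ := fun k =>
    {τ | ∀ y x, |u (y + x) τ + u (y - x) τ - 2 * u y τ| ≤ k * ‖x‖ ^ 2}
  have hT (k : ℕ) : IsClosed (T k) := by
    simp only [T, ofPred_forall]
    refine isClosed_iInter fun y => isClosed_iInter fun x => isClosed_le ?_ continuous_const
    exact (((h.continuous_time _).add (h.continuous_time _)).sub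
      (continuous_const.mul (h.continuous_time _))).abs
  have hTu : ⋃ k, ((↑) ⁻¹' T k : Set P) = univ := by
    refine eq_univ_of_forall fun τ => mem_iUnion.2 ?_
    obtain ⟨k, hk⟩ := exists_abs_second_difference_le (h.contDiff τ) (h.hasCompactSupport τ)
    refine ⟨⌈k⌉₊, fun y x => (hk y x).trans ?_⟩
    gcongr
    exact Nat.le_ceil k
  obtain ⟨k, ⟨τ₀, hτ₀P⟩, hτ₀⟩ := nonempty_interior_of_iUnion_of_closed
    (fun k => (hT k).preimage continuous_subtype_val) hTu
  obtain ⟨V, hV, hVT⟩ := (mem_nhds_subtype P _ _).1 (mem_interior_iff_mem_nhds.1 hτ₀)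
  obtain ⟨l, r, hlr, hsub⟩ := mem_nhds_iff_exists_Ioo_subset.1
    (inter_mem hV (Iio_mem_nhds hτ₀P.1))
  have hr0 : r ≤ 0 := by
    by_contra! hr
    have : max ((τ₀ + r) / 2) 0 ∈ Ioo l r :=
      ⟨lt_max_of_lt_left (by linarith [hlr.1, hlr.2]), max_lt (by linarith [hlr.2]) hr⟩
    have h0 : max ((τ₀ + r) / 2) 0 < 0 := (hsub this).2
    exact (le_max_right _ _).not_gt h0
  have hgood := h.mollifiedHeat_of_bound hΩ (P := P) (l := l) (r := r) (k := k) hr0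
    (Nat.cast_nonneg k) (fun p q hpq => ?_) (fun τ hτ hτP => ?_) (fun τ hτ hτP => ?_)
  · exact hτ₀P.2 (mem_interior.2 ⟨Ioo l r, hgood, isOpen_Ioo, hlr⟩)
  · have : P ∩ Icc p q = Gᶜ ∩ Icc p q := by
      ext s
      simp only [P, mem_inter_iff, mem_Iio]
      exact ⟨fun hs => ⟨hs.1.2, hs.2⟩, fun hs => ⟨⟨(hsub (hpq hs.2)).2, hs.1⟩, hs.2⟩⟩
    rw [this]
    exact hGc.inter isClosed_Icc
  · by_contra hcon
    exact hτP ⟨(hsub hτ).2, fun hG => hcon (interior_subset hG)⟩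
  · exact hVT (show (⟨τ, hτP⟩ : P) ∈ (↑) ⁻¹' V from (hsub hτ).1)

end CutoffCaloric

/-! ### Cutting off and comparison on an annulus -/

/-- Cutting off a caloric function on `(ℝⁿ \ {e}) × (-∞, 0]` outside an annulus centred at `e`. -/
lemma exists_cutoffCaloric {e : 𝔼} {φ : 𝔼 → ℝ → ℝ} {B r R : ℝ}
    (hreg : ∀ τ : ℝ, τ ≤ 0 → ContDiffOn ℝ 2 (fun z => φ z τ) {e}ᶜ)
    (hpde : ∀ z, z ≠ e → ∀ τ : ℝ, τ ≤ 0 →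
      HasDerivAt (fun τ' => φ z τ') (laplacian n (fun y => φ y τ) z) τ)
    (hB : 0 ≤ B) (hbdd : ∀ z, z ≠ e → ∀ τ : ℝ, τ ≤ 0 → |φ z τ| ≤ B) (hr : 0 < r) (hrR : r < R) :
    ∃ u S, CutoffCaloric u S B {z | r < ‖z - e‖ ∧ ‖z - e‖ < R} ∧
      ∀ z, r < ‖z - e‖ → ‖z - e‖ < R → ∀ τ ≤ 0, u z τ = φ z τ := by
  let f : ContDiffBump e := ⟨R, R + 1, hr.trans hrR, by linarith⟩
  let g : ContDiffBump e := ⟨r / 2, r, by linarith, by linarith⟩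
  set χ : 𝔼 → ℝ := fun z => f z - g z with hχ
  have hχC : ContDiff ℝ 2 χ := f.contDiff.sub g.contDiff
  have hχ0 (z : 𝔼) (hz : ‖z - e‖ < r / 2) : χ z = 0 := by
    rw [hχ]
    simp only
    rw [f.one_of_mem_closedBall, g.one_of_mem_closedBall, sub_self]
    · simpa [dist_eq_norm, g] using hz.le
    · simp only [Metric.mem_closedBall, dist_eq_norm, f]
      linarith
  have hχ1 (z : 𝔼) (h1 : r < ‖z - e‖) (h2 : ‖z - e‖ < R) : χ z = 1 := by
    rw [hχ]
    simp only
    rw [f.one_of_mem_closedBall, g.zero_of_le_dist, sub_zero]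
    · simpa [dist_eq_norm, g] using h1.le
    · simpa [dist_eq_norm, f] using h2.le
  have hχe : χ e = 0 := hχ0 e (by simpa using hr)
  have hχabs (z : 𝔼) : |χ z| ≤ 1 :=
    abs_le.2 ⟨by linarith [f.nonneg (x := z), g.le_one (x := z)],
      by linarith [f.le_one (x := z), g.nonneg (x := z)]⟩
  have hopen : IsOpen {z : 𝔼 | r < ‖z - e‖ ∧ ‖z - e‖ < R} :=
    (isOpen_lt (by fun_prop) (by fun_prop)).and (isOpen_lt (by fun_prop) (by fun_prop))
  have hne (z : 𝔼) (hz : r < ‖z - e‖) : z ≠ e := by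
    rintro rfl
    simp at hz
    linarith
  refine ⟨fun z τ => χ z * φ z (min τ 0), Metric.closedBall e (R + 1),
    ⟨isCompact_closedBall _ _, fun τ => contDiff_iff_contDiffAt.2 fun z => ?_, fun τ z hz => ?_,
      fun z τ => ?_, fun z => ?_, fun z hz τ hτ => ?_⟩, fun z h1 h2 τ hτ => ?_⟩
  · rcases eq_or_ne z e with rfl | hz
    · refine (contDiffAt_const (c := (0 : ℝ))).congr_of_eventuallyEq ?_
      filter_upwards [Metric.ball_mem_nhds z (half_pos hr)] with y hy
      rw [hχ0 y (by simpa [dist_eq_norm] using hy), zero_mul]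
    · exact hχC.contDiffAt.mul
        ((hreg _ (min_le_right τ 0)).contDiffAt (isOpen_compl_singleton.mem_nhds hz))
  · simp only [Metric.mem_closedBall, not_le] at hz
    have h1 : f z = 0 := f.zero_of_le_dist hz.le
    have h2 : g z = 0 := g.zero_of_le_dist (by
      simp only [g]
      linarith)
    simp [hχ, h1, h2]
  · rcases eq_or_ne z e with rfl | hz
    · simpa [hχe] using hB
    · rw [abs_mul]
      exact (mul_le_of_le_one_left (abs_nonneg _) (hχabs z)).trans (hbdd z hz _ (min_le_right τ 0))
  · rcases eq_or_ne z e with rfl | hz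
    · simpa [hχe] using continuous_const
    · have hc : ContinuousOn (φ z) (Iic 0) := fun τ hτ =>
        (hpde z hz τ hτ).continuousAt.continuousWithinAt
      exact continuous_const.mul
        (hc.comp_continuous (continuous_id.min continuous_const) fun τ => min_le_right τ 0)
  · have hlap : laplacian n (fun y => χ y * φ y (min τ 0)) z = laplacian n (fun y => φ y τ) z := by
      refine laplacian_congr ?_
      filter_upwards [hopen.mem_nhds hz] with y hy
      rw [hχ1 y hy.1 hy.2, one_mul, min_eq_left hτ.le]
    rw [hlap]
    refine (hpde z (hne z hz.1) τ hτ.le).congr_of_eventuallyEq ?_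
    filter_upwards [Iio_mem_nhds hτ] with s hs
    rw [hχ1 z hz.1 hz.2, one_mul, min_eq_left (mem_Iio.1 hs).le]
  · simp only
    rw [hχ1 z h1 h2, one_mul, min_eq_left hτ]

/-- Comparison, on an annulus, with a barrier that decays in time up to a small logarithm. -/
lemma CutoffCaloric.abs_le_barrier {u : 𝔼 → ℝ → ℝ} {S : Set 𝔼} {B δ L γ ε : ℝ} {e : 𝔼}
    (h : CutoffCaloric u S B {z | δ / 2 < ‖z - e‖ ∧ ‖z - e‖ < 2 * L}) (hn : 3 ≤ n) (hB : 0 ≤ B)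
    (hδ : 0 < δ) (hδL : δ ≤ L) (hγ : 0 ≤ γ) (hε : 0 < ε)
    (hinner : B ≤ ε * (Real.log (L ^ 2) - Real.log (δ ^ 2)))
    (houter : ∀ y, L / 2 < ‖y - e‖ → ‖y - e‖ < 2 * L → ∀ τ ≤ 0, |u y τ| ≤ γ)
    {z : 𝔼} (hzδ : δ ≤ ‖z - e‖) (hzL : ‖z - e‖ ≤ L) {a τ : ℝ} (haτ : a ≤ τ) (hτ : τ < 0) :
    |u z τ| ≤ γ + B / L ^ 2 * Real.exp (-(τ - a) / L ^ 2) * (2 * L ^ 2 - ‖z - e‖ ^ 2)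
      + ε * (Real.log (L ^ 2) - Real.log (‖z - e‖ ^ 2)) := by
  have hL : 0 < L := hδ.trans_le hδL
  have hopen : IsOpen {z : 𝔼 | δ / 2 < ‖z - e‖ ∧ ‖z - e‖ < 2 * L} :=
    (isOpen_lt (by fun_prop) (by fun_prop)).and (isOpen_lt (by fun_prop) (by fun_prop))
  have hheat := h.mollifiedHeat hopen
  obtain ⟨b, hb, hbr⟩ := exists_bumps_tendsto_zero (n := n) (δ / 4) (by linarith)
  refine le_of_tendsto (tendsto_mollify_of_rOut hb (h.contDiff τ).continuous z).abs
    (Eventually.of_forall fun i => ?_)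
  replace hbr := hbr i
  generalize b i = b at hbr
  set U : 𝔼 → ℝ → ℝ := fun z τ => mollify (b.normed volume) (fun x => u x τ) z with hU
  set K : Set 𝔼 := {x | δ ≤ ‖x - e‖ ∧ ‖x - e‖ ≤ L} with hK
  have hKc : IsCompact K := by
    refine (isCompact_closedBall e L).of_isClosed_subset ?_ fun x hx => ?_
    · exact (isClosed_le (by fun_prop) (by fun_prop)).and (isClosed_le (by fun_prop) (by fun_prop))
    · simpa [dist_eq_norm] using hx.2
  have hKint (x : 𝔼) (h1 : δ < ‖x - e‖) (h2 : ‖x - e‖ < L) : x ∈ interior K :=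
    mem_interior.2 ⟨{x | δ < ‖x - e‖ ∧ ‖x - e‖ < L}, fun y hy => ⟨hy.1.le, hy.2.le⟩,
      (isOpen_lt (by fun_prop) (by fun_prop)).and (isOpen_lt (by fun_prop) (by fun_prop)), h1, h2⟩
  have hKne (x : 𝔼) (hx : x ∈ K) : x ≠ e := by
    rintro rfl
    have := hx.1
    simp at this
    linarith
  have hlog (x : 𝔼) (hx : x ∈ K) : 0 ≤ Real.log (L ^ 2) - Real.log (‖x - e‖ ^ 2) := by
    have h1 : 0 < ‖x - e‖ := hδ.trans_le hx.1
    have h2 := hx.2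
    exact sub_nonneg.2 (Real.log_le_log (by positivity) (by gcongr))
  have hquad (x : 𝔼) (hx : x ∈ K) : L ^ 2 ≤ 2 * L ^ 2 - ‖x - e‖ ^ 2 := by
    have : ‖x - e‖ ^ 2 ≤ L ^ 2 := by
      have := hx.2
      gcongr
    linarith
  have hUc : Continuous fun p : 𝔼 × ℝ => U p.1 p.2 := h.continuous_mollify b
  set E : ℝ → ℝ := fun s => B / L ^ 2 * Real.exp (-(s - a) / L ^ 2) with hE
  have hE0 (s : ℝ) : 0 ≤ E s := by positivity
  set w : 𝔼 → ℝ → ℝ := fun x s => γ + E s * (2 * L ^ 2 - ‖x - e‖ ^ 2)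
    + ε * (Real.log (L ^ 2) - Real.log (‖x - e‖ ^ 2)) with hw
  have key (σ : ℝ) (hσ : |σ| = 1) : σ * U z τ - w z τ ≤ 0 := by
    have habs (x : ℝ) : σ * x ≤ |x| := by
      simpa [abs_mul, hσ] using le_abs_self (σ * x)
    refine nonpos_of_strict_subcaloric hKc (a := a) (b := τ) (v := fun x s => σ * U x s - w x s)
      ?_ ?_ ?_ ?_ ?_ z ⟨hzδ, hzL⟩ τ ⟨haτ, le_rfl⟩
    · have e1 : Continuous fun p : K × Icc a τ => U p.1 p.2 :=
        hUc.comp (f := fun p : K × Icc a τ => ((p.1, p.2) : 𝔼 × ℝ)) (by fun_prop)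
      have e2 : Continuous fun p : K × Icc a τ => Real.log (‖(p.1 : 𝔼) - e‖ ^ 2) := by
        refine Continuous.log (by fun_prop) fun p => ?_
        simpa [sub_eq_zero] using hKne p.1 p.1.2
      have e3 : Continuous fun p : K × Icc a τ => E p.2 := by
        simp only [hE]
        fun_prop
      simp only [hw]
      fun_prop
    · intro x hx
      have h1 : B ≤ E a * (2 * L ^ 2 - ‖x - e‖ ^ 2) := by
        calc B = E a * L ^ 2 := by simp [hE, hL.ne']
          _ ≤ _ := mul_le_mul_of_nonneg_left (hquad x hx) (hE0 a)
      have h2 := mul_nonneg hε.le (hlog x hx)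
      have h3 := (habs (U x a)).trans (h.abs_mollify_le b x a)
      simp only [hw]
      linarith
    · intro x hx hxi s hs
      have hquad' : 0 ≤ E s * (2 * L ^ 2 - ‖x - e‖ ^ 2) :=
        mul_nonneg (hE0 s) ((sq_nonneg L).trans (hquad x hx))
      have hor : ‖x - e‖ = δ ∨ ‖x - e‖ = L := by
        by_contra! hne
        exact hxi (hKint x (lt_of_le_of_ne hx.1 hne.1.symm) (lt_of_le_of_ne hx.2 hne.2))
      rcases hor with hx' | hx'
      · have h3 := (habs (U x s)).trans (h.abs_mollify_le b x s)
        simp only [hw]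
        rw [hx'] at hquad' ⊢
        linarith
      · have h2 := mul_nonneg hε.le (hlog x hx)
        have h3 : |U x s| ≤ γ := by
          refine abs_mollify_normed_le b fun t ht => ?_
          rw [mem_ball_zero_iff] at ht
          have h4 : x - t - e = x - e - t := by abel
          have h5 := norm_sub_norm_le (x - e) t
          have h6 := norm_sub_le (x - e) t
          exact houter _ (by rw [h4]; linarith) (by rw [h4]; linarith) s (hs.2.trans hτ.le)
        have h4 := habs (U x s)
        simp only [hw]
        linarith
    all_goals
      intro x hx s hs
      have hxK := interior_subset hx
      have hxe := hKne x hxK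
      have c1 : ContDiffAt ℝ 2 (fun x => U x s) x := (h.contDiff_mollify b s).contDiffAt
      have c2 : ContDiffAt ℝ 2 (fun x : 𝔼 => ‖x - e‖ ^ 2) x := (contDiff_norm_sub_sq e).contDiffAt
      have c3 := contDiffAt_log_norm_sub_sq hxe
      have c4 : ContDiffAt ℝ 2 (fun x : 𝔼 => E s * (2 * L ^ 2 - ‖x - e‖ ^ 2)) x :=
        contDiffAt_const.mul (contDiffAt_const.sub c2)
      have c5 : ContDiffAt ℝ 2 (fun x : 𝔼 => ε * (Real.log (L ^ 2) - Real.log (‖x - e‖ ^ 2))) x :=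
        contDiffAt_const.mul (contDiffAt_const.sub c3)
      have c6 : ContDiffAt ℝ 2 (fun x => w x s) x := (contDiffAt_const.add c4).add c5
      have c7 : ContDiffAt ℝ 2 (fun x => σ * U x s) x := contDiffAt_const.mul c1
    · exact c7.sub c6
    · have hlap : laplacian n (fun x => σ * U x s - w x s) x
          = σ * laplacian n (fun x => U x s) x
            - (E s * (0 - 2 * n) + ε * (0 - (2 * n - 4) / ‖x - e‖ ^ 2)) := by
        rw [laplacian_sub c7 c6, laplacian_const_mul _ c1, hw,
          laplacian_add (contDiffAt_const.add c4) c5, laplacian_add contDiffAt_const c4,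
          laplacian_const, laplacian_const_mul _ (contDiffAt_const.sub c2),
          laplacian_const_mul _ (contDiffAt_const.sub c3), laplacian_sub contDiffAt_const c2,
          laplacian_sub contDiffAt_const c3, laplacian_const, laplacian_const,
          laplacian_norm_sub_sq, laplacian_log_norm_sub_sq hxe, zero_add]
      have d1 : HasDerivAt (U x) (laplacian n (fun x => U x s) x) s := by
        refine hheat s (hs.2.trans_lt hτ) b x fun y hy => ?_
        rw [Metric.mem_closedBall, dist_eq_norm] at hy
        have h1 := norm_sub_le_norm_sub_add_norm_sub x y e
        have h2 := norm_sub_le_norm_sub_add_norm_sub y x e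
        rw [norm_sub_rev x y] at h1
        have h3 := hxK.1
        have h4 := hxK.2
        exact ⟨by linarith, by linarith⟩
      have d2 : HasDerivAt E (E s * (-1 / L ^ 2)) s := by
        have d0 : HasDerivAt (fun s => -(s - a) / L ^ 2) (-1 / L ^ 2) s :=
          ((hasDerivAt_id s).sub_const a).neg.div_const (L ^ 2)
        simp only [hE, mul_assoc]
        exact d0.exp.const_mul (B / L ^ 2)
      have d3 : HasDerivAt (w x) (E s * (-1 / L ^ 2) * (2 * L ^ 2 - ‖x - e‖ ^ 2)) s :=
        ((d2.mul_const _).const_add γ).add_const _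
      refine ⟨_, ?_, (d1.const_mul σ).sub d3⟩
      rw [hlap]
      have hn' : (3 : ℝ) ≤ n := by exact_mod_cast hn
      have hq : 0 < ‖x - e‖ ^ 2 := by
        have := hδ.trans_le hxK.1
        positivity
      have hpos : 0 < ε * ((2 * n - 4) / ‖x - e‖ ^ 2) :=
        mul_pos hε (div_pos (by linarith) hq)
      have hdecay : E s * (1 / L ^ 2) * (2 * L ^ 2 - ‖x - e‖ ^ 2) ≤ E s * 2 := by
        rw [mul_assoc]
        refine mul_le_mul_of_nonneg_left ?_ (hE0 s)
        rw [one_div_mul_eq_div, div_le_iff₀ (by positivity)]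
        linarith
      have hEn : E s * 3 ≤ E s * n := mul_le_mul_of_nonneg_left hn' (hE0 s)
      have hE0s := hE0 s
      have hneg : E s * (-1 / L ^ 2) * (2 * L ^ 2 - ‖x - e‖ ^ 2)
        = -(E s * (1 / L ^ 2) * (2 * L ^ 2 - ‖x - e‖ ^ 2)) := by ring
      rw [hneg]
      linarith
  have k1 := key 1 (by simp)
  have k2 := key (-1) (by simp)
  exact abs_le.2 ⟨by linarith, by linarith⟩

end

/-- Liouville/removable-singularity property: a bounded ancient caloric function on
`(ℝⁿ \ {e}) × (-∞,0]` satisfying `|φ(z,τ)| ≤ |z-e|^{-α}` with `0 < α < n-2`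
vanishes identically. -/
theorem ancient_caloric_vanishes (n : ℕ) (hn : 3 ≤ n) (α : ℝ)
    (hα : α ∈ Set.Ioo (0 : ℝ) ((n : ℝ) - 2))
    (e : EuclideanSpace ℝ (Fin n)) (he : ‖e‖ = 1)
    (φ : EuclideanSpace ℝ (Fin n) → ℝ → ℝ)
    (hreg : ∀ τ : ℝ, τ ≤ 0 → ContDiffOn ℝ 2 (fun z => φ z τ) {e}ᶜ)
    (hpde : ∀ z, z ≠ e → ∀ τ : ℝ, τ ≤ 0 →
      HasDerivAt (fun τ' => φ z τ') (laplacian n (fun y => φ y τ) z) τ)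
    (hbdd : ∃ B : ℝ, ∀ z, z ≠ e → ∀ τ : ℝ, τ ≤ 0 → |φ z τ| ≤ B)
    (hdec : ∀ z, z ≠ e → ∀ τ : ℝ, τ ≤ 0 → |φ z τ| ≤ ‖z - e‖ ^ (-α)) :
    ∀ z, z ≠ e → ∀ τ : ℝ, τ ≤ 0 → φ z τ = 0 := by
  intro z hz
  obtain ⟨B, hB⟩ := hbdd
  have hz0 : 0 < ‖z - e‖ := norm_pos_iff.2 (sub_ne_zero.2 hz)
  have hB0 : 0 ≤ B := (abs_nonneg _).trans (hB z hz 0 le_rfl)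
  have hlt (τ : ℝ) (hτ : τ < 0) : φ z τ = 0 := by
    refine abs_nonpos_iff.1 (le_of_forall_pos_le_add fun γ hγ => ?_)
    rw [zero_add]
    -- an outer radius beyond which the decay bound gives `γ`
    obtain ⟨L, hLγ, hL0, hzL⟩ : ∃ L : ℝ, (L / 2) ^ (-α) ≤ γ ∧ 0 < L ∧ ‖z - e‖ ≤ L := by
      have h1 : Filter.Tendsto (fun L : ℝ => (L / 2) ^ (-α)) Filter.atTop (nhds 0) :=
        (tendsto_rpow_neg_atTop hα.1).comp (Filter.tendsto_id.atTop_div_const two_pos)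
      exact ((h1.eventually (ge_mem_nhds hγ)).and ((Filter.eventually_gt_atTop 0).and
        (Filter.eventually_ge_atTop ‖z - e‖))).exists
    have hε (ε : ℝ) (hε : 0 < ε) :
        |φ z τ| ≤ γ + ε * (Real.log (L ^ 2) - Real.log (‖z - e‖ ^ 2)) := by
      obtain ⟨δ, hδ0, hδz, hδB⟩ : ∃ δ : ℝ, 0 < δ ∧ δ ≤ ‖z - e‖ ∧
          B ≤ ε * (Real.log (L ^ 2) - Real.log (δ ^ 2)) := by
        have h1 := Real.tendsto_log_nhdsGT_zero.eventually
          (Filter.eventually_le_atBot ((Real.log (L ^ 2) - B / ε) / 2))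
        obtain ⟨δ, hδ, h2⟩ := (h1.and (Ioc_mem_nhdsGT hz0)).exists
        refine ⟨δ, h2.1, h2.2, ?_⟩
        rw [← div_le_iff₀' hε, Real.log_pow δ]
        push_cast
        linarith
      obtain ⟨u, S, hu, huφ⟩ := exists_cutoffCaloric (r := δ / 2) (R := 2 * L) hreg hpde hB0 hB
        (half_pos hδ0) (by linarith)
      have houter (y : EuclideanSpace ℝ (Fin n)) (h1 : L / 2 < ‖y - e‖) (h2 : ‖y - e‖ < 2 * L)
          (s : ℝ) (hs : s ≤ 0) : |u y s| ≤ γ := by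
        have hy : y ≠ e := sub_ne_zero.1 (norm_pos_iff.1 ((half_pos hL0).trans h1))
        rcases lt_or_ge (δ / 2) ‖y - e‖ with h3 | h3
        · rw [huφ y h3 h2 s hs]
          exact (hdec y hy s hs).trans ((Real.rpow_le_rpow_of_nonpos (half_pos hL0) h1.le
            (neg_nonpos.2 hα.1.le)).trans hLγ)
        · linarith
      have hcomp (a : ℝ) (ha : a ≤ τ) := hu.abs_le_barrier hn hB0 hδ0 (hδz.trans hzL) hγ.le hε hδB
        houter hδz hzL ha hτ
      rw [huφ z (by linarith) (by linarith) τ hτ.le] at hcomp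
      have hexp : Filter.Tendsto (fun a : ℝ => Real.exp (-(τ - a) / L ^ 2)) Filter.atBot
          (nhds 0) := by
        refine Real.tendsto_exp_atBot.comp (Filter.Tendsto.atBot_div_const (by positivity) ?_)
        simpa [sub_eq_add_neg] using Filter.tendsto_atBot_add_const_right _ (-τ) Filter.tendsto_id
      have hlim := (((hexp.const_mul (B / L ^ 2)).mul_const
        (2 * L ^ 2 - ‖z - e‖ ^ 2)).const_add γ).add_const
          (ε * (Real.log (L ^ 2) - Real.log (‖z - e‖ ^ 2)))
      simp only [mul_zero, zero_mul, add_zero] at hlim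
      exact ge_of_tendsto hlim ((Filter.eventually_le_atBot τ).mono hcomp)
    have hlim : Filter.Tendsto
        (fun ε : ℝ => γ + ε * (Real.log (L ^ 2) - Real.log (‖z - e‖ ^ 2)))
        (nhdsWithin 0 (Set.Ioi 0)) (nhds γ) := by
      exact (Continuous.tendsto' (by fun_prop) 0 γ (by simp)).mono_left nhdsWithin_le_nhds
    exact ge_of_tendsto hlim (Filter.eventually_of_mem self_mem_nhdsWithin hε)
  intro τ hτ
  rcases hτ.lt_or_eq with hτ | rfl
  · exact hlt τ hτ
  · have hc : Filter.Tendsto (φ z) (nhdsWithin 0 (Set.Iio 0)) (nhds (φ z 0)) :=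
      (hpde z hz 0 le_rfl).continuousAt.tendsto.mono_left nhdsWithin_le_nhds
    exact tendsto_nhds_unique hc (tendsto_const_nhds.congr'
      (Filter.eventually_of_mem self_mem_nhdsWithin fun s hs => (hlt s hs).symm))
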